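/- arXiv:2008.09235 — 2 statements merged into one kernel-verified Lean document; each statement's English description precedes it below -/
import Mathlib

section
/- Let u ∈ (0,1) and for m ∈ ℤ let v_{2m}^{(u)}(x) = (1+x²)^{−(1+u)/2} ((1+xi)/(1−xi))^m. Then the double integral I_m(u) := ∫_ℝ ∫_ℝ v_{2m}^{(u)}(x) · conj(v_{2m}^{(u)}(y)) · |x−y|^{u−1} dx dy converges absolutely, is a positive real number, and there exist constants c'_u, c_u > 0 (depending only on u) such that c'_u (1+|m|)^{−u} ≤ I_m(u) ≤ c_u (1+|m|)^{−u} for all m ∈ ℤ. -/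
open MeasureTheory Real Set Filter Complex
open scoped ENNReal NNReal

noncomputable section

/-- The weight-`2m` K-type vector `v_{2m}^{(u)}(x) = (1+x²)^{−(1+u)/2} ((1+xi)/(1−xi))^m`
of the principal series `P(u,+)` in the noncompact picture. -/
def vEven (u : ℂ) (m : ℤ) (x : ℝ) : ℂ :=
  ((1 + x ^ 2 : ℝ) : ℂ) ^ (-(1 + u) / 2) *
    ((1 + (x : ℂ) * Complex.I) / (1 - (x : ℂ) * Complex.I)) ^ m

/-- The kernel `|sin t|^{u-1}` twisted by the character `e^{2imt}`. -/
def sinKernel (u : ℝ) (m : ℤ) (t : ℝ) : ℂ :=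
  Complex.exp (2 * m * t * Complex.I) * ((|Real.sin t| ^ (u - 1) : ℝ) : ℂ)

/-- The Fourier coefficient of `|sin t|^{u-1}` of frequency `2m` over one period. -/
def sinCoeff (u : ℝ) (m : ℤ) : ℂ := ∫ t in (0 : ℝ)..π, sinKernel u m t

theorem sinKernel_periodic (u : ℝ) (m : ℤ) : Function.Periodic (sinKernel u m) π := by
  intro t
  have h : (2 * m * ((t + π : ℝ) : ℂ) * Complex.I) =
      2 * m * t * Complex.I + m * (2 * π * Complex.I) := by push_cast; ring
  simp only [sinKernel]
  rw [h, Complex.exp_add, Complex.exp_int_mul_two_pi_mul_I, Real.sin_add_pi, abs_neg, mul_one]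

theorem norm_sinKernel (u : ℝ) (m : ℤ) (t : ℝ) :
    ‖sinKernel u m t‖ = |Real.sin t| ^ (u - 1) := by
  have h : (2 * m * (t : ℂ) * Complex.I) = ((2 * m * t : ℝ) : ℂ) * Complex.I := by push_cast; ring
  rw [sinKernel, norm_mul, h, Complex.norm_exp_ofReal_mul_I, one_mul, Complex.norm_real,
    Real.norm_of_nonneg (by positivity)]

theorem measurable_sinKernel (u : ℝ) (m : ℤ) : Measurable (sinKernel u m) := by
  unfold sinKernel
  fun_prop

theorem intervalIntegrable_abs_sin_rpow {u : ℝ} (hu : u ∈ Set.Ioo (0 : ℝ) 1) :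
    IntervalIntegrable (fun t => |Real.sin t| ^ (u - 1)) volume 0 π := by
  have hpi := Real.pi_pos
  have h1 : IntervalIntegrable (fun t : ℝ => t ^ (u - 1)) volume 0 π :=
    intervalIntegral.intervalIntegrable_rpow' (by linarith [hu.1])
  have h2 : IntervalIntegrable (fun t : ℝ => (π - t) ^ (u - 1)) volume 0 π := by
    simpa using (h1.comp_sub_left π).symm
  refine ((h1.add h2).const_mul ((2 / π) ^ (u - 1))).mono_fun'
    (Measurable.pow_const (by fun_prop) _).aestronglyMeasurable ?_
  rw [uIoc_of_le hpi.le, ← Measure.restrict_congr_set Ioo_ae_eq_Ioc]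
  filter_upwards [ae_restrict_mem measurableSet_Ioo] with t ht
  obtain ⟨h0, hπ⟩ := ht
  rw [Real.norm_of_nonneg (by positivity), abs_of_pos (Real.sin_pos_of_pos_of_lt_pi h0 hπ)]
  have key : ∀ s : ℝ, 0 < s → s ≤ π / 2 →
      Real.sin s ^ (u - 1) ≤ (2 / π) ^ (u - 1) * s ^ (u - 1) := by
    intro s hs hs'
    rw [← Real.mul_rpow (by positivity) hs.le]
    exact Real.rpow_le_rpow_of_nonpos (by positivity) (Real.mul_le_sin hs.le hs')
      (by linarith [hu.2])
  have p1 : 0 ≤ t ^ (u - 1) := by positivity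
  have p2 : 0 ≤ (π - t) ^ (u - 1) := Real.rpow_nonneg (by linarith) _
  have p3 : 0 ≤ (2 / π) ^ (u - 1) := by positivity
  rcases le_total t (π / 2) with h | h
  · refine (key t h0 h).trans ?_
    gcongr
    linarith
  · have := key (π - t) (by linarith) (by linarith)
    rw [Real.sin_pi_sub] at this
    refine this.trans ?_
    gcongr
    linarith

theorem intervalIntegrable_sinKernel {u : ℝ} (hu : u ∈ Set.Ioo (0 : ℝ) 1) (m : ℤ) :
    IntervalIntegrable (sinKernel u m) volume 0 π := by
  refine (intervalIntegrable_abs_sin_rpow hu).mono_fun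
    (measurable_sinKernel u m).aestronglyMeasurable (Eventually.of_forall fun t => ?_)
  simp only [norm_sinKernel]
  exact le_abs_self _

theorem sinCoeff_succ {u : ℝ} (hu : u ∈ Set.Ioo (0 : ℝ) 1) (m : ℤ) :
    (2 * m + 1 + u : ℂ) * sinCoeff u (m + 1) = (2 * m + 1 - u) * sinCoeff u m := by
  have hker (n : ℤ) := intervalIntegrable_sinKernel hu n
  have hi1 := (hker (m + 1)).const_mul ((2 * m + 1 + u : ℂ) / 2)
  have hi2 := (hker m).const_mul ((2 * m + 1 - u : ℂ) / 2)
  have hcont : ContinuousOn (fun t : ℝ => ((Real.sin t ^ u : ℝ) : ℂ) *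
      Complex.exp ((2 * m + 1) * Complex.I * t)) (Icc 0 π) := by
    have : Continuous (fun t : ℝ => Real.sin t ^ u) :=
      Real.continuous_sin.rpow_const fun _ => Or.inr hu.1.le
    fun_prop
  have hderiv : ∀ t ∈ Ioo (0 : ℝ) π, HasDerivAt (fun t : ℝ => ((Real.sin t ^ u : ℝ) : ℂ) *
      Complex.exp ((2 * m + 1) * Complex.I * t))
      ((2 * m + 1 + u : ℂ) / 2 * sinKernel u (m + 1) t
        - (2 * m + 1 - u : ℂ) / 2 * sinKernel u m t) t := by
    intro t ht
    have hs : 0 < Real.sin t := Real.sin_pos_of_pos_of_lt_pi ht.1 ht.2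
    have h1 : HasDerivAt (fun t : ℝ => ((Real.sin t ^ u : ℝ) : ℂ)) _ t :=
      ((Real.hasDerivAt_sin t).rpow_const (p := u) (Or.inl hs.ne')).ofReal_comp
    have h2 : HasDerivAt (fun t : ℝ => Complex.exp ((2 * m + 1) * Complex.I * t)) _ t :=
      (((hasDerivAt_id (t : ℂ)).const_mul ((2 * m + 1) * Complex.I)).cexp).comp_ofReal
    refine (h1.mul h2).congr_deriv ?_
    have hsu : Real.sin t ^ u = Real.sin t * Real.sin t ^ (u - 1) := by
      rw [Real.rpow_sub_one hs.ne']; field_simp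
    simp only [sinKernel, abs_of_pos hs, hsu, id]
    have e1 : Complex.exp (2 * (m + 1 : ℤ) * t * Complex.I) =
        Complex.exp ((2 * m + 1) * Complex.I * t) * Complex.exp (t * Complex.I) := by
      rw [← Complex.exp_add]; push_cast; ring_nf
    have e2 : Complex.exp (2 * m * t * Complex.I) =
        Complex.exp ((2 * m + 1) * Complex.I * t) * Complex.exp ((-t : ℂ) * Complex.I) := by
      rw [← Complex.exp_add]; ring_nf
    rw [e1, e2, Complex.exp_mul_I, Complex.exp_mul_I, Complex.cos_neg, Complex.sin_neg]
    push_cast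
    ring
  have := intervalIntegral.integral_eq_sub_of_hasDerivAt_of_le Real.pi_pos.le hcont hderiv
    (hi1.sub hi2)
  rw [intervalIntegral.integral_sub hi1 hi2, intervalIntegral.integral_const_mul,
    intervalIntegral.integral_const_mul] at this
  simp only [Real.sin_pi, Real.sin_zero, Real.zero_rpow hu.1.ne', Complex.ofReal_zero,
    zero_mul, sub_zero] at this
  rw [sinCoeff, sinCoeff]
  linear_combination 2 * this

/-- The product `∏_{j<n} (2j+1-u)/(2j+1+u)`. -/
def coeffRatio (u : ℝ) (n : ℕ) : ℝ := ∏ j ∈ Finset.range n, (2 * j + 1 - u) / (2 * j + 1 + u)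

theorem coeffRatio_pos {u : ℝ} (hu : u ∈ Set.Ioo (0 : ℝ) 1) (n : ℕ) : 0 < coeffRatio u n := by
  obtain ⟨h0, h1⟩ := hu
  refine Finset.prod_pos fun j _ => ?_
  have : (0 : ℝ) ≤ j := j.cast_nonneg
  exact div_pos (by linarith) (by linarith)

theorem coeffRatio_succ (u : ℝ) (n : ℕ) :
    coeffRatio u (n + 1) = coeffRatio u n * ((2 * n + 1 - u) / (2 * n + 1 + u)) :=
  Finset.prod_range_succ _ _

theorem sinCoeff_natCast {u : ℝ} (hu : u ∈ Set.Ioo (0 : ℝ) 1) (n : ℕ) :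
    sinCoeff u n = coeffRatio u n * sinCoeff u 0 ∧
      sinCoeff u (-n) = coeffRatio u n * sinCoeff u 0 := by
  induction n with
  | zero => simp [coeffRatio]
  | succ n ih =>
    have hne : (2 * n + 1 + u : ℂ) ≠ 0 := by
      have : (2 * n + 1 + u : ℝ) ≠ 0 := by have := hu.1; positivity
      exact_mod_cast this
    rw [coeffRatio_succ]
    push_cast
    have r1 := sinCoeff_succ hu n
    have r2 := sinCoeff_succ hu (-(n + 1 : ℤ))
    rw [show -(n + 1 : ℤ) + 1 = -n by ring, ih.2] at r2
    rw [ih.1] at r1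
    push_cast at r1 r2
    constructor
    · field_simp
      linear_combination r1
    · rw [show (-(n + 1 : ℤ)) = -1 + -(n : ℤ) by ring] at *
      field_simp
      linear_combination r2

theorem sinCoeff_eq {u : ℝ} (hu : u ∈ Set.Ioo (0 : ℝ) 1) (m : ℤ) :
    sinCoeff u m = coeffRatio u m.natAbs * sinCoeff u 0 := by
  rcases Int.natAbs_eq m with h | h
  · rw [← (sinCoeff_natCast hu _).1, ← h]
  · rw [← (sinCoeff_natCast hu _).2, ← h]

theorem sinCoeff_zero {u : ℝ} (hu : u ∈ Set.Ioo (0 : ℝ) 1) :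
    ∃ K : ℝ, 0 < K ∧ sinCoeff u 0 = K := by
  refine ⟨∫ t in (0 : ℝ)..π, |Real.sin t| ^ (u - 1), ?_, ?_⟩
  · refine intervalIntegral.intervalIntegral_pos_of_pos_on (intervalIntegrable_abs_sin_rpow hu)
      (fun t ht => ?_) Real.pi_pos
    have := Real.sin_pos_of_pos_of_lt_pi ht.1 ht.2
    positivity
  · simp [sinCoeff, sinKernel, ← intervalIntegral.integral_ofReal]

theorem coeffRatio_le {u : ℝ} (hu : u ∈ Set.Ioo (0 : ℝ) 1) (n : ℕ) :
    coeffRatio u n ≤ (1 + n : ℝ) ^ (-u) := by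
  obtain ⟨h0, h1⟩ := hu
  have hn (n : ℕ) : (0 : ℝ) ≤ n := n.cast_nonneg
  have key : coeffRatio u n * (2 * n + 1 - u) ^ u ≤ (1 - u) ^ u := by
    induction n with
    | zero => simp [coeffRatio]
    | succ n ih =>
      have hx : 0 < 2 * n + 1 - u := by linarith [hn n]
      refine le_trans ?_ ih
      rw [coeffRatio_succ, mul_assoc]
      refine mul_le_mul_of_nonneg_left ?_ (coeffRatio_pos ⟨h0, h1⟩ n).le
      have hb := rpow_one_add_le_one_add_mul_self (s := 2 / (2 * n + 1 - u))
        (by linarith [div_pos two_pos hx]) h0.le h1.le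
      have e : (2 * (n + 1 : ℕ) + 1 - u : ℝ) =
          (2 * n + 1 - u) * (1 + 2 / (2 * n + 1 - u)) := by
        push_cast; field_simp; ring
      rw [e, Real.mul_rpow hx.le (by positivity)]
      have hy : 0 < 2 * n + 1 + u := by linarith [hn n]
      calc (2 * n + 1 - u) / (2 * n + 1 + u) * ((2 * n + 1 - u) ^ u *
            (1 + 2 / (2 * n + 1 - u)) ^ u)
          ≤ (2 * n + 1 - u) / (2 * n + 1 + u) * ((2 * n + 1 - u) ^ u *
            (1 + u * (2 / (2 * n + 1 - u)))) := by gcongr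
        _ = (2 * n + 1 - u) ^ u := by field_simp; ring
  have h1u : 0 < 1 - u := by linarith
  have hle : (1 - u) ^ u * (1 + n : ℝ) ^ u ≤ (2 * n + 1 - u) ^ u := by
    rw [← Real.mul_rpow h1u.le (by positivity)]
    refine Real.rpow_le_rpow (by positivity) ?_ h0.le
    nlinarith [hn n]
  rw [Real.rpow_neg (by positivity), ← one_div, le_div_iff₀ (by positivity)]
  have hp : 0 < (1 - u) ^ u := by positivity
  nlinarith [mul_le_mul_of_nonneg_left hle (coeffRatio_pos ⟨h0, h1⟩ n).le]

theorem exists_le_coeffRatio {u : ℝ} (hu : u ∈ Set.Ioo (0 : ℝ) 1) :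
    ∃ c : ℝ, 0 < c ∧ ∀ n : ℕ, c * (1 + n : ℝ) ^ (-u) ≤ coeffRatio u n := by
  have hu' := hu
  obtain ⟨h0, h1⟩ := hu
  have hn (n : ℕ) : (0 : ℝ) ≤ n := n.cast_nonneg
  have key (n : ℕ) : coeffRatio u 1 * (1 + u) ^ u ≤
      coeffRatio u (n + 1) * (2 * n + 1 + u) ^ u := by
    induction n with
    | zero => simp
    | succ n ih =>
      refine ih.trans ?_
      rw [coeffRatio_succ u (n + 1), mul_assoc]
      refine mul_le_mul_of_nonneg_left ?_ (coeffRatio_pos hu' _).le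
      push_cast
      have hy : 0 < 2 * (n + 1 : ℝ) + 1 + u := by linarith [hn n]
      have hx : 0 < 2 * (n : ℝ) + 1 + u := by linarith [hn n]
      have hb := rpow_one_add_le_one_add_mul_self (s := -(2 / (2 * (n + 1 : ℝ) + 1 + u)))
        (by rw [neg_le_neg_iff, div_le_one hy]; linarith [hn n]) h0.le h1.le
      have e : 2 * (n : ℝ) + 1 + u =
          (2 * (n + 1 : ℝ) + 1 + u) * (1 + -(2 / (2 * (n + 1 : ℝ) + 1 + u))) := by
        field_simp; ring
      have hnn : 0 ≤ 1 + -(2 / (2 * (n + 1 : ℝ) + 1 + u)) := by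
        rw [e] at hx; exact (pos_of_mul_pos_right hx hy.le).le
      rw [e, Real.mul_rpow hy.le hnn]
      calc (2 * (n + 1 : ℝ) + 1 + u) ^ u * (1 + -(2 / (2 * (n + 1 : ℝ) + 1 + u))) ^ u
          ≤ (2 * (n + 1 : ℝ) + 1 + u) ^ u *
            (1 + u * -(2 / (2 * (n + 1 : ℝ) + 1 + u))) := by gcongr
        _ = (2 * (n + 1 : ℝ) + 1 - u) / (2 * (n + 1 : ℝ) + 1 + u) *
            (2 * (n + 1 : ℝ) + 1 + u) ^ u := by field_simp; ring
  have hc : 0 < coeffRatio u 1 * (1 + u) ^ u * 2 ^ (-u) := by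
    have := coeffRatio_pos hu' 1
    positivity
  refine ⟨min 1 (coeffRatio u 1 * (1 + u) ^ u * 2 ^ (-u)), lt_min one_pos hc, fun n => ?_⟩
  cases n with
  | zero => simp [coeffRatio]
  | succ n =>
    have hle : (2 * n + 1 + u) ^ u ≤ 2 ^ u * (1 + (n + 1 : ℕ) : ℝ) ^ u := by
      rw [← Real.mul_rpow two_pos.le (by positivity)]
      refine Real.rpow_le_rpow (by linarith [hn n]) ?_ h0.le
      push_cast
      linarith
    refine (mul_le_mul_of_nonneg_right (min_le_right _ _) (by positivity)).trans ?_
    rw [Real.rpow_neg two_pos.le, Real.rpow_neg (by positivity), ← div_eq_mul_inv,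
      ← div_eq_mul_inv, div_div, div_le_iff₀ (by positivity)]
    exact (key n).trans (mul_le_mul_of_nonneg_left hle (coeffRatio_pos hu' _).le)

theorem integrable_and_integral_of_comp_tan {E : Type*} [NormedAddCommGroup E] [NormedSpace ℝ E]
    {g h : ℝ → E} {a θ : ℝ} (hper : Function.Periodic h π)
    (hker : IntervalIntegrable h volume 0 π)
    (hgh : ∀ φ ∈ Ioo (-(π / 2)) (π / 2),
      (1 / Real.cos φ ^ 2) • g (Real.tan φ) = a • h (θ - φ)) :
    Integrable g ∧ ∫ y, g y = a • ∫ t in (0 : ℝ)..π, h t := by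
  have hlt : -(π / 2) ≤ π / 2 := by linarith [Real.pi_pos]
  have hd : ∀ φ ∈ Ioo (-(π / 2)) (π / 2),
      HasDerivWithinAt Real.tan (1 / Real.cos φ ^ 2) (Ioo (-(π / 2)) (π / 2)) φ := fun φ hφ =>
    (Real.hasDerivAt_tan (Real.cos_pos_of_mem_Ioo hφ).ne').hasDerivWithinAt
  have hgh' : ∀ φ ∈ Ioo (-(π / 2)) (π / 2),
      |1 / Real.cos φ ^ 2| • g (Real.tan φ) = a • h (θ - φ) := fun φ hφ => by
    rw [abs_of_nonneg (by positivity), hgh φ hφ]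
  have hI : IntervalIntegrable (fun φ => a • h (θ - φ)) volume (-(π / 2)) (π / 2) := by
    have := (hper.intervalIntegrable₀ Real.pi_pos.ne' hker
      (θ - (-(π / 2))) (θ - π / 2)).comp_sub_left θ
    rw [sub_sub_cancel, sub_sub_cancel] at this
    exact this.smul a
  constructor
  · rw [← integrableOn_univ, ← Real.image_tan_Ioo,
      integrableOn_image_iff_integrableOn_abs_deriv_smul measurableSet_Ioo hd Real.injOn_tan,
      integrableOn_congr_fun hgh' measurableSet_Ioo,
      ← intervalIntegrable_iff_integrableOn_Ioo_of_le hlt]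
    exact hI
  · rw [← setIntegral_univ, ← Real.image_tan_Ioo,
      integral_image_eq_integral_abs_deriv_smul measurableSet_Ioo hd Real.injOn_tan,
      setIntegral_congr_fun measurableSet_Ioo hgh', ← integral_Ioc_eq_integral_Ioo,
      ← intervalIntegral.integral_of_le hlt, intervalIntegral.integral_smul,
      intervalIntegral.integral_comp_sub_left (fun t => h t) θ]
    congr 1
    have := hper.intervalIntegral_add_eq (θ - π / 2) 0
    rw [zero_add] at this
    rw [← this]
    congr 1
    ring

theorem vEven_tan (u : ℝ) (m : ℤ) {φ : ℝ} (hφ : φ ∈ Ioo (-(π / 2)) (π / 2)) :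
    vEven u m (Real.tan φ) =
      ((Real.cos φ ^ (1 + u) : ℝ) : ℂ) * Complex.exp (2 * m * φ * Complex.I) := by
  have hc := Real.cos_pos_of_mem_Ioo hφ
  have hc' : (Real.cos φ : ℂ) ≠ 0 := by exact_mod_cast hc.ne'
  rw [vEven]
  congr 1
  · rw [← inv_inv (1 + Real.tan φ ^ 2), Real.inv_one_add_tan_sq hc.ne',
      show (-(1 + u) / 2 : ℂ) = ((-(1 + u) / 2 : ℝ) : ℂ) by push_cast; rfl,
      ← Complex.ofReal_cpow (by positivity), Real.inv_rpow (by positivity),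
      ← Real.rpow_neg (by positivity), ← Real.rpow_natCast, ← Real.rpow_mul hc.le]
    congr 2
    push_cast
    ring
  · rw [show (2 * m * φ * Complex.I : ℂ) = m * (2 * φ * Complex.I) by ring, Complex.exp_int_mul]
    congr 1
    rw [show (2 * φ * Complex.I : ℂ) = φ * Complex.I - (-φ : ℂ) * Complex.I by ring,
      Complex.exp_sub, Complex.exp_mul_I, Complex.exp_mul_I, Complex.cos_neg, Complex.sin_neg,
      Real.tan_eq_sin_div_cos]
    push_cast at hc' ⊢
    rw [← mul_div_mul_left _ _ hc']
    congr 1 <;> field_simp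
    ring

/-- The integrand of the complementary-series pairing of `v_{2m}^{(u)}` with itself. -/
def pairingKernel (u : ℝ) (m : ℤ) (q : ℝ × ℝ) : ℂ :=
  vEven (u : ℂ) m q.1 * (starRingEnd ℂ) (vEven (u : ℂ) m q.2) *
    ((|q.1 - q.2| ^ (u - 1) : ℝ) : ℂ)

theorem measurable_pairingKernel (u : ℝ) (m : ℤ) : Measurable (pairingKernel u m) := by
  have hv : Measurable (vEven u m) := by
    unfold vEven
    fun_prop
  have h2 : Measurable fun q : ℝ × ℝ => (starRingEnd ℂ) (vEven (u : ℂ) m q.2) :=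
    Complex.continuous_conj.measurable.comp (hv.comp measurable_snd)
  unfold pairingKernel
  fun_prop

theorem pairingKernel_tan (u : ℝ) (m : ℤ) {θ φ : ℝ} (hθ : θ ∈ Ioo (-(π / 2)) (π / 2))
    (hφ : φ ∈ Ioo (-(π / 2)) (π / 2)) :
    (1 / Real.cos φ ^ 2) • pairingKernel u m (Real.tan θ, Real.tan φ) =
      (Real.cos θ ^ 2) • sinKernel u m (θ - φ) := by
  have ha := Real.cos_pos_of_mem_Ioo hθ
  have hb := Real.cos_pos_of_mem_Ioo hφ
  have hsub : |Real.tan θ - Real.tan φ| =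
      |Real.sin (θ - φ)| * (Real.cos θ * Real.cos φ)⁻¹ := by
    rw [← abs_of_pos (inv_pos.2 (mul_pos ha hb)), ← abs_mul, Real.tan_eq_sin_div_cos,
      Real.tan_eq_sin_div_cos, Real.sin_sub]
    congr 1
    field_simp
  have hreal : 1 / Real.cos φ ^ 2 * (Real.cos θ ^ (1 + u) * Real.cos φ ^ (1 + u) *
      |Real.tan θ - Real.tan φ| ^ (u - 1)) =
      Real.cos θ ^ 2 * |Real.sin (θ - φ)| ^ (u - 1) := by
    rw [hsub, Real.mul_rpow (abs_nonneg _) (by positivity), Real.inv_rpow (by positivity),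
      Real.mul_rpow ha.le hb.le]
    have h (c : ℝ) (hc : 0 < c) : c ^ (1 + u) = c ^ 2 * c ^ (u - 1) := by
      rw [← Real.rpow_natCast, ← Real.rpow_add hc]
      congr 1
      push_cast
      ring
    rw [h _ ha, h _ hb]
    field_simp
  have hexp : Complex.exp (2 * m * θ * Complex.I) *
      (starRingEnd ℂ) (Complex.exp (2 * m * φ * Complex.I)) =
      Complex.exp (2 * m * ((θ - φ : ℝ) : ℂ) * Complex.I) := by
    rw [← Complex.exp_conj, ← Complex.exp_add]
    congr 1
    simp [Complex.conj_ofNat]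
    ring
  have hrealC := congrArg (fun r : ℝ => (r : ℂ)) hreal
  simp only [Complex.ofReal_mul] at hrealC
  rw [pairingKernel, sinKernel, vEven_tan u m hθ, vEven_tan u m hφ, ← hexp]
  simp only [Complex.real_smul, map_mul, Complex.conj_ofReal, Complex.ofReal_pow] at hrealC ⊢
  linear_combination (Complex.exp (2 * m * θ * Complex.I) *
      (starRingEnd ℂ) (Complex.exp (2 * m * φ * Complex.I))) * hrealC

theorem pairingKernel_section {u : ℝ} (hu : u ∈ Set.Ioo (0 : ℝ) 1) (m : ℤ) (x : ℝ) :
    Integrable (fun y => pairingKernel u m (x, y)) ∧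
      ∫ y, pairingKernel u m (x, y) = ((1 + x ^ 2)⁻¹ : ℝ) • sinCoeff u m := by
  have := integrable_and_integral_of_comp_tan (g := fun y => pairingKernel u m (x, y))
    (a := (1 + x ^ 2)⁻¹) (θ := Real.arctan x) (sinKernel_periodic u m)
    (intervalIntegrable_sinKernel hu m) fun φ hφ => by
      have := pairingKernel_tan u m (Real.arctan_mem_Ioo x) hφ
      rwa [Real.tan_arctan, Real.cos_sq_arctan, one_div (1 + x ^ 2)] at this
  exact this

theorem integral_norm_pairingKernel {u : ℝ} (hu : u ∈ Set.Ioo (0 : ℝ) 1) (m : ℤ) (x : ℝ) :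
    ∫ y, ‖pairingKernel u m (x, y)‖ =
      (1 + x ^ 2)⁻¹ * ∫ t in (0 : ℝ)..π, ‖sinKernel u m t‖ :=
  (integrable_and_integral_of_comp_tan (g := fun y => ‖pairingKernel u m (x, y)‖)
    (a := (1 + x ^ 2)⁻¹) (θ := Real.arctan x)
    (fun t => by simp only [sinKernel_periodic u m t])
    (intervalIntegrable_sinKernel hu m).norm fun φ hφ => by
      have := congrArg norm (pairingKernel_tan u m (Real.arctan_mem_Ioo x) hφ)
      rw [Real.tan_arctan, Real.cos_sq_arctan, one_div (1 + x ^ 2), norm_smul, norm_smul,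
        Real.norm_of_nonneg (by positivity), Real.norm_of_nonneg (by positivity)] at this
      exact this).2

theorem integrable_pairingKernel {u : ℝ} (hu : u ∈ Set.Ioo (0 : ℝ) 1) (m : ℤ) :
    Integrable (pairingKernel u m) := by
  rw [Measure.volume_eq_prod,
    integrable_prod_iff (measurable_pairingKernel u m).aestronglyMeasurable]
  refine ⟨Eventually.of_forall fun x => (pairingKernel_section hu m x).1, ?_⟩
  simp only [integral_norm_pairingKernel hu m]
  exact integrable_inv_one_add_sq.mul_const _

theorem integral_pairingKernel {u : ℝ} (hu : u ∈ Set.Ioo (0 : ℝ) 1) (m : ℤ) :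
    ∫ q, pairingKernel u m q = π * sinCoeff u m := by
  have hi := integrable_pairingKernel hu m
  rw [Measure.volume_eq_prod] at hi ⊢
  rw [integral_prod _ hi]
  simp only [(pairingKernel_section hu m _).2]
  rw [integral_smul_const, integral_univ_inv_one_add_sq, Complex.real_smul]

/-- the complementary-series pairing
`I_m(u) = ∫∫ v_{2m}^{(u)}(x) conj(v_{2m}^{(u)}(y)) |x−y|^{u−1} dx dy` converges absolutely,
is a positive real number, and satisfies `c'_u (1+|m|)^{−u} ≤ I_m(u) ≤ c_u (1+|m|)^{−u}`. -/
theorem stmt12 (u : ℝ) (hu : u ∈ Set.Ioo (0 : ℝ) 1) :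
    ∃ c' c : ℝ, 0 < c' ∧ 0 < c ∧
      ∀ m : ℤ,
        Integrable (fun q : ℝ × ℝ =>
          vEven (u : ℂ) m q.1 * (starRingEnd ℂ) (vEven (u : ℂ) m q.2) *
            ((|q.1 - q.2| ^ (u - 1) : ℝ) : ℂ)) volume ∧
        (∫ q : ℝ × ℝ,
            vEven (u : ℂ) m q.1 * (starRingEnd ℂ) (vEven (u : ℂ) m q.2) *
              ((|q.1 - q.2| ^ (u - 1) : ℝ) : ℂ)).im = 0 ∧
        0 < (∫ q : ℝ × ℝ,
            vEven (u : ℂ) m q.1 * (starRingEnd ℂ) (vEven (u : ℂ) m q.2) *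
              ((|q.1 - q.2| ^ (u - 1) : ℝ) : ℂ)).re ∧
        c' * (1 + |(m : ℝ)|) ^ (-u) ≤
          (∫ q : ℝ × ℝ,
            vEven (u : ℂ) m q.1 * (starRingEnd ℂ) (vEven (u : ℂ) m q.2) *
              ((|q.1 - q.2| ^ (u - 1) : ℝ) : ℂ)).re ∧
        (∫ q : ℝ × ℝ,
            vEven (u : ℂ) m q.1 * (starRingEnd ℂ) (vEven (u : ℂ) m q.2) *
              ((|q.1 - q.2| ^ (u - 1) : ℝ) : ℂ)).re ≤ c * (1 + |(m : ℝ)|) ^ (-u) := by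
  obtain ⟨K, hK, hK0⟩ := sinCoeff_zero hu
  obtain ⟨c, hc, hlow⟩ := exists_le_coeffRatio hu
  have hpi := Real.pi_pos
  refine ⟨π * K * c, π * K, by positivity, by positivity, fun m => ?_⟩
  have hval : (∫ q : ℝ × ℝ, vEven (u : ℂ) m q.1 * (starRingEnd ℂ) (vEven (u : ℂ) m q.2) *
      ((|q.1 - q.2| ^ (u - 1) : ℝ) : ℂ)) = ((π * K * coeffRatio u m.natAbs : ℝ) : ℂ) := by
    have := integral_pairingKernel hu m
    rw [sinCoeff_eq hu, hK0] at this
    refine this.trans ?_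
    push_cast
    ring
  have hm : |(m : ℝ)| = (m.natAbs : ℝ) := by
    rw [Nat.cast_natAbs, Int.cast_abs]
  rw [hval, Complex.ofReal_im, Complex.ofReal_re, hm]
  have hpos := coeffRatio_pos hu m.natAbs
  refine ⟨integrable_pairingKernel hu m, rfl, by positivity, ?_, ?_⟩
  · rw [mul_assoc (π * K)]
    exact mul_le_mul_of_nonneg_left (hlow _) (by positivity)
  · exact mul_le_mul_of_nonneg_left (coeffRatio_le hu _) (by positivity)
end
end

section
/- Let u ∈ (−1, 0) and λ ∈ ℝ, and for m ∈ ℤ let v_{2m}^{(iλ)}(x) = (1+x²)^{−(1+iλ)/2} ((1+xi)/(1−xi))^m. Then there exists a constant c_u > 0 (depending on u and λ) such that for all m ∈ ℤ: ⫴v_{2m}^{(iλ)}⫴²_u := ∫₀^{2π} ∫_ℝ |ξ|^{−u} |𝓕(π_{iλ,+}(k_{θ₀}) v_{2m}^{(iλ)})(ξ)|² dξ dθ₀ ≤ c_u (1+|m|)^{−u} (the inner improper Fourier transforms existing for all ξ ≠ 0). -/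
open MeasureTheory Real Set Filter Complex
open scoped ENNReal NNReal

noncomputable section

/-- `z` is the improper Fourier transform of `g` at `ξ`:
`z = lim_{R→∞} ∫_{−R}^R g(x) e^{−2πixξ} dx`. -/
def IsImpFT (g : ℝ → ℂ) (ξ : ℝ) (z : ℂ) : Prop :=
  Filter.Tendsto
    (fun R : ℝ => ∫ x in Set.Ioc (-R) R,
      g x * Complex.exp (-2 * (Real.pi : ℂ) * Complex.I * (x : ℂ) * (ξ : ℂ)))
    Filter.atTop (nhds z)

/-- The principal-series rotation action
`(π_{s,+}(k_θ)v)(x) = |cos θ − x sin θ|^{−1−s} v((x cos θ + sin θ)/(cos θ − x sin θ))`. -/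
def piPlus (s : ℂ) (θ : ℝ) (v : ℝ → ℂ) (x : ℝ) : ℂ :=
  ((|Real.cos θ - x * Real.sin θ| : ℝ) : ℂ) ^ (-1 - s) *
    v ((x * Real.cos θ + Real.sin θ) / (Real.cos θ - x * Real.sin θ))

/-- The nonspherical principal-series rotation action, with the sign factor
`sgn(cos θ − x sin θ)`. -/
def piMinus (s : ℂ) (θ : ℝ) (v : ℝ → ℂ) (x : ℝ) : ℂ :=
  ((Real.sign (Real.cos θ - x * Real.sin θ) : ℝ) : ℂ) *
    ((|Real.cos θ - x * Real.sin θ| : ℝ) : ℂ) ^ (-1 - s) *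
    v ((x * Real.cos θ + Real.sin θ) / (Real.cos θ - x * Real.sin θ))

/-- `arccot x = π/2 − arctan x ∈ (0, π)`. -/
def arccot (x : ℝ) : ℝ := Real.pi / 2 - Real.arctan x

open FourierTransform in
open scoped SchwartzMap in
/-- **Plancherel**: on `L¹ ∩ L²` the Fourier integral preserves the `L²` norm. -/
theorem lintegral_enorm_fourier_sq {g : ℝ → ℂ} (hg₁ : Integrable g) (hg₂ : MemLp g 2) :
    ∫⁻ ξ, ‖𝓕 g ξ‖ₑ ^ 2 = ∫⁻ x, ‖g x‖ₑ ^ 2 := by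
  set G : Lp ℂ 2 (volume : Measure ℝ) := hg₂.toLp g with hG
  have hcont : Continuous (𝓕 g) :=
    VectorFourier.fourierIntegral_continuous (L := innerₗ ℝ) Real.continuous_fourierChar
      continuous_inner hg₁
  have hae : ∀ᵐ ξ, (𝓕 G : Lp ℂ 2 (volume : Measure ℝ)) ξ = 𝓕 g ξ := by
    refine ae_eq_of_integral_contDiff_smul_eq ((Lp.memLp _).locallyIntegrable (by norm_num))
      hcont.locallyIntegrable fun φ hφ hφc => ?_
    have hψc : HasCompactSupport (fun x => (φ x : ℂ)) :=
      hφc.comp_left (g := fun t : ℝ => (t : ℂ)) (by simp)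
    let ψ : 𝓢(ℝ, ℂ) := hψc.toSchwartzMap (Complex.ofRealCLM.contDiff.comp hφ)
    have hψ : ∀ x, ψ x = (φ x : ℂ) := fun x => rfl
    have h₁ := DFunLike.congr_fun (Lp.fourier_toTemperedDistribution_eq G) ψ
    rw [TemperedDistribution.fourier_apply, Lp.toTemperedDistribution_apply,
      Lp.toTemperedDistribution_apply] at h₁
    have h₂ : ∫ x, (𝓕 ψ) x • G x = ∫ x, 𝓕 (ψ : ℝ → ℂ) x • g x := by
      refine integral_congr_ae ?_
      filter_upwards [hg₂.coeFn_toLp] with x hx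
      rw [hG, hx, SchwartzMap.fourier_coe]
    have h₃ : ∫ x, 𝓕 (ψ : ℝ → ℂ) x • g x = ∫ x, ψ x • 𝓕 g x := by
      simpa using! VectorFourier.integral_fourierIntegral_smul_eq_flip (L := innerₗ ℝ)
        Real.continuous_fourierChar continuous_inner ψ.integrable hg₁
    have h₄ := h₁.symm.trans (h₂.trans h₃)
    simpa [hψ] using h₄
  have key : eLpNorm (𝓕 g) 2 volume = eLpNorm g 2 volume := by
    rw [← eLpNorm_congr_ae hae, ← eLpNorm_congr_ae hg₂.coeFn_toLp]
    have := Lp.norm_fourier_eq G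
    rw [Lp.norm_def, Lp.norm_def] at this
    exact (ENNReal.toReal_eq_toReal_iff' (Lp.eLpNorm_ne_top _) (Lp.eLpNorm_ne_top _)).1 this
  have h := congrArg (fun t => t ^ (2 : ℝ)) key
  have e := fun f : ℝ → ℂ => eLpNorm_nnreal_pow_eq_lintegral (f := f) (μ := volume)
    (p := 2) two_ne_zero
  simp only [NNReal.coe_ofNat, ENNReal.coe_ofNat, ENNReal.rpow_ofNat] at h e
  rwa [e, e] at h

open FourierTransform in
/-- The improper Fourier transform of a `C¹` function vanishing at infinity with integrable
derivative, by integration by parts. -/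
theorem isImpFT_of_hasDerivAt {f f' : ℝ → ℂ} (hf : ∀ x, HasDerivAt f (f' x) x)
    (hf' : Continuous f') (hint : Integrable f') (htop : Tendsto f atTop (nhds 0))
    (hbot : Tendsto f atBot (nhds 0)) {ξ : ℝ} (hξ : ξ ≠ 0) :
    IsImpFT f ξ (𝓕 f' ξ / (2 * π * Complex.I * ξ)) := by
  set a : ℂ := -2 * (π : ℂ) * Complex.I * ξ with ha
  have ha0 : a ≠ 0 := by simp [ha, hξ, Real.pi_ne_zero]
  let e : ℝ → ℂ := fun x => Complex.exp (a * x)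
  have he : ∀ x : ℝ, HasDerivAt e (a * e x) x := fun x => by
    have h := ((Complex.ofRealCLM.hasDerivAt (x := x)).const_mul a).cexp
    simpa [e, mul_comm] using h
  have hec : Continuous e := by fun_prop
  have hnorm : ∀ x, ‖e x‖ = 1 := fun x => by
    have : a * x = ((-2 * π * ξ * x : ℝ) : ℂ) * Complex.I := by rw [ha]; push_cast; ring
    simp only [e, this, Complex.norm_exp_ofReal_mul_I]
  have hFT : 𝓕 f' ξ = ∫ x, f' x * e x := by
    rw [Real.fourier_real_eq_integral_exp_smul]
    refine integral_congr_ae (ae_of_all _ fun x => ?_)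
    simp only [smul_eq_mul, e, ha]
    rw [mul_comm]
    congr 2
    push_cast; ring
  have hint' : Integrable fun x => f' x * e x :=
    hint.mul_bdd (c := 1) hec.aestronglyMeasurable (ae_of_all _ fun x => (hnorm x).le)
  have hlim : Tendsto (fun R : ℝ => (f R * e R - f (-R) * e (-R)
      - ∫ x in (-R)..R, f' x * e x) / a) atTop (nhds ((0 - 0 - 𝓕 f' ξ) / a)) := by
    have hz : ∀ {l : Filter ℝ} {p : ℝ → ℝ}, Tendsto (fun R => f (p R)) l (nhds 0) →
        Tendsto (fun R => f (p R) * e (p R)) l (nhds 0) := fun {l p} h => by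
      rw [tendsto_zero_iff_norm_tendsto_zero] at h ⊢
      simpa [hnorm] using h
    refine ((((hz (p := fun R => R) htop).sub
      (hz (p := fun R => -R) (hbot.comp tendsto_neg_atTop_atBot))).sub ?_).div_const a)
    rw [hFT]
    exact intervalIntegral_tendsto_integral hint' tendsto_neg_atTop_atBot tendsto_id
  have hval : (0 - 0 - 𝓕 f' ξ) / a = 𝓕 f' ξ / (2 * π * Complex.I * ξ) := by
    rw [ha]
    have : (2 * π * Complex.I * ξ : ℂ) ≠ 0 := by simp [hξ, Real.pi_ne_zero]
    have h2 : (-2 * π * Complex.I * ξ : ℂ) = -(2 * π * Complex.I * ξ) := by ring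
    rw [h2, sub_zero, zero_sub, neg_div_neg_eq]
  rw [hval] at hlim
  refine hlim.congr' ?_
  filter_upwards [eventually_ge_atTop 0] with R hR
  rw [← intervalIntegral.integral_of_le (by linarith)]
  have hIBP := intervalIntegral.integral_mul_deriv_eq_deriv_mul (a := -R) (b := R)
    (u := f) (v := e) (u' := f') (v' := fun x => a * e x) (fun x _ => hf x) (fun x _ => he x)
    (hf'.intervalIntegrable _ _) ((continuous_const.mul hec).intervalIntegrable _ _)
  rw [← hIBP, div_eq_iff ha0, ← intervalIntegral.integral_mul_const]
  refine intervalIntegral.integral_congr fun x _ => ?_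
  simp only [e, ha]
  rw [show -2 * (π : ℂ) * Complex.I * ξ * x = -2 * π * Complex.I * x * ξ by ring]
  ring

open FourierTransform in
/-- The improper Fourier transform of a continuous `L²` function does not increase
the `L²` norm. -/
theorem lintegral_enorm_sq_le_of_isImpFT {f F : ℝ → ℂ} (hf : Continuous f)
    (hF : ∀ ξ ≠ 0, IsImpFT f ξ (F ξ)) :
    ∫⁻ ξ, ‖F ξ‖ₑ ^ 2 ≤ ∫⁻ x, ‖f x‖ₑ ^ 2 := by
  let g : ℕ → ℝ → ℂ := fun n => (Ioc (-(n : ℝ)) n).indicator f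
  have hg₁ : ∀ n, Integrable (g n) := fun n =>
    (integrable_indicator_iff measurableSet_Ioc).2
      ((hf.integrableOn_Icc).mono_set Ioc_subset_Icc_self)
  have hg₂ : ∀ n, MemLp (g n) 2 := fun n => by
    obtain ⟨C, hC⟩ := isCompact_Icc.exists_bound_of_continuousOn
      (hf.continuousOn (s := Icc (-(n : ℝ)) n))
    refine (memLp_indicator_iff_restrict measurableSet_Ioc).2 ?_
    refine MemLp.of_bound hf.aestronglyMeasurable C ?_
    filter_upwards [ae_restrict_mem measurableSet_Ioc] with x hx
    exact hC x (Ioc_subset_Icc_self hx)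
  have hcont : ∀ n, Continuous (𝓕 (g n)) := fun n =>
    VectorFourier.fourierIntegral_continuous (L := innerₗ ℝ) Real.continuous_fourierChar
      continuous_inner (hg₁ n)
  have hlim : ∀ ξ ≠ 0, Tendsto (fun n => 𝓕 (g n) ξ) atTop (nhds (F ξ)) := fun ξ hξ => by
    refine ((hF ξ hξ).comp tendsto_natCast_atTop_atTop).congr fun n => ?_
    rw [Real.fourier_real_eq_integral_exp_smul, Function.comp_apply,
      ← integral_indicator measurableSet_Ioc]
    refine integral_congr_ae (ae_of_all _ fun x => ?_)
    by_cases hx : x ∈ Ioc (-(n : ℝ)) n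
    · simp only [g, indicator_of_mem hx, smul_eq_mul]
      rw [mul_comm]
      congr 2
      push_cast; ring
    · simp [g, indicator_of_notMem hx]
  have h0 : ∀ᵐ ξ : ℝ, ξ ≠ 0 := by simp [ae_iff]
  calc ∫⁻ ξ, ‖F ξ‖ₑ ^ 2
      = ∫⁻ ξ, liminf (fun n => ‖𝓕 (g n) ξ‖ₑ ^ 2) atTop := by
        refine lintegral_congr_ae ?_
        filter_upwards [h0] with ξ hξ
        exact (((ENNReal.continuous_pow 2).tendsto _).comp
          (hlim ξ hξ).enorm).liminf_eq.symm
    _ ≤ liminf (fun n => ∫⁻ ξ, ‖𝓕 (g n) ξ‖ₑ ^ 2) atTop :=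
        lintegral_liminf_le fun n => (hcont n).enorm.measurable.pow_const 2
    _ ≤ liminf (fun _ : ℕ => ∫⁻ x, ‖f x‖ₑ ^ 2) atTop := by
        refine liminf_le_liminf (Eventually.of_forall fun n => ?_)
        rw [lintegral_enorm_fourier_sq (hg₁ n) (hg₂ n)]
        refine lintegral_mono fun x => ?_
        gcongr
        exact enorm_indicator_le_enorm_self _ _
    _ = ∫⁻ x, ‖f x‖ₑ ^ 2 := by simp

/-- The Cayley factor `(1+xi)/(1−xi)` has modulus one. -/
theorem norm_cayley (x : ℝ) :
    ‖(1 + (x : ℂ) * Complex.I) / (1 - (x : ℂ) * Complex.I)‖ = 1 := by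
  have h : (1 - (x : ℂ) * Complex.I) = starRingEnd ℂ (1 + (x : ℂ) * Complex.I) := by
    simp [sub_eq_add_neg]
  rw [norm_div, h, Complex.norm_conj, div_self]
  intro h0
  have := congrArg Complex.re (norm_eq_zero.1 h0)
  simp at this

theorem norm_vEven_sq (lam : ℝ) (m : ℤ) (x : ℝ) :
    ‖vEven (Complex.I * lam) m x‖ ^ 2 = (1 + x ^ 2)⁻¹ := by
  have hp : 0 < 1 + x ^ 2 := by positivity
  rw [vEven, norm_mul, norm_zpow, norm_cayley, one_zpow, mul_one,
    Complex.norm_cpow_eq_rpow_re_of_pos hp, ← Real.rpow_natCast, ← Real.rpow_mul hp.le,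
    ← Real.rpow_neg_one]
  congr 1
  simp

theorem one_add_mul_I_ne_zero (x : ℝ) : (1 + (x : ℂ) * Complex.I) ≠ 0 := fun h => by
  simpa using congrArg Complex.re h

theorem one_sub_mul_I_ne_zero (x : ℝ) : (1 - (x : ℂ) * Complex.I) ≠ 0 := fun h => by
  simpa using congrArg Complex.re h

theorem hasDerivAt_vEven (s : ℂ) (m : ℤ) (x : ℝ) :
    HasDerivAt (vEven s m)
      (vEven s m x * ((2 * m * Complex.I - (1 + s) * x) / (1 + (x : ℂ) ^ 2))) x := by
  have hx : HasDerivAt (fun y : ℝ => (y : ℂ)) 1 x := by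
    simpa using! Complex.ofRealCLM.hasDerivAt (x := x)
  have hn := one_add_mul_I_ne_zero x
  have hd := one_sub_mul_I_ne_zero x
  have hfac : (1 + (x : ℂ) ^ 2) = (1 + (x : ℂ) * Complex.I) * (1 - (x : ℂ) * Complex.I) := by
    linear_combination ((x : ℂ) ^ 2) * Complex.I_sq
  have hq : (1 + (x : ℂ) ^ 2) ≠ 0 := hfac ▸ mul_ne_zero hn hd
  have hslit : (1 + (x : ℂ) ^ 2) ∈ Complex.slitPlane := by
    rw [show (1 + (x : ℂ) ^ 2) = ((1 + x ^ 2 : ℝ) : ℂ) by push_cast; ring]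
    exact Complex.ofReal_mem_slitPlane.2 (by positivity)
  have h₁ := ((hasStrictDerivAt_cpow_const (c := -(1 + s) / 2) hslit).hasDerivAt).comp x
    ((hx.pow 2).const_add 1)
  have h₂ := (hasDerivAt_zpow m _ (Or.inl (div_ne_zero hn hd))).comp x
    (((hx.mul_const Complex.I).const_add 1).div ((hx.mul_const Complex.I).const_sub 1) hd)
  have h := h₁.mul h₂
  have hfun : vEven s m = ((fun z : ℂ => z ^ (-(1 + s) / 2)) ∘ fun y : ℝ => 1 + (y : ℂ) ^ 2) *
      ((fun z : ℂ => z ^ m) ∘ fun y : ℝ => (1 + (y : ℂ) * Complex.I) / (1 - (y : ℂ) * Complex.I)) := by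
    ext y; simp [vEven]
  rw [hfun]
  refine h.congr_deriv ?_
  simp only [Function.comp_apply, Pi.div_apply, Pi.pow_apply, Pi.mul_apply]
  rw [Complex.cpow_sub _ _ hq, Complex.cpow_one, zpow_sub_one₀ (div_ne_zero hn hd), inv_div]
  generalize (1 + (x : ℂ) ^ 2) ^ (-(1 + s) / 2) = P
  generalize ((1 + (x : ℂ) * Complex.I) / (1 - (x : ℂ) * Complex.I)) ^ m = W
  rw [hfac]
  field_simp
  push_cast
  ring

/-- The K-type vectors are eigenvectors of the rotation action, off the singular point. -/
theorem piPlus_vEven (s : ℂ) (m : ℤ) (θ x : ℝ) (hx : Real.cos θ - x * Real.sin θ ≠ 0) :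
    piPlus s θ (vEven s m) x = Complex.exp (2 * m * θ * Complex.I) * vEven s m x := by
  set d := Real.cos θ - x * Real.sin θ with hd
  have hda : 0 < |d| := abs_pos.2 hx
  have hdc : (d : ℂ) ≠ 0 := by exact_mod_cast hx
  have hp : 0 < 1 + x ^ 2 := by positivity
  have hq : 1 + ((x * Real.cos θ + Real.sin θ) / d) ^ 2 = (1 + x ^ 2) * (|d| ^ 2)⁻¹ := by
    rw [sq_abs]
    field_simp
    rw [hd]
    linear_combination (1 + x ^ 2) * Real.sin_sq_add_cos_sq θ
  have hpow : ((1 + ((x * Real.cos θ + Real.sin θ) / d) ^ 2 : ℝ) : ℂ) ^ (-(1 + s) / 2) =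
      ((1 + x ^ 2 : ℝ) : ℂ) ^ (-(1 + s) / 2) * ((|d| : ℝ) : ℂ) ^ (1 + s) := by
    rw [hq, Complex.ofReal_mul, Complex.mul_cpow_ofReal_nonneg hp.le (by positivity)]
    congr 1
    have hdn : ((|d| : ℝ) : ℂ) ≠ 0 := by exact_mod_cast hda.ne'
    have hinv : (((|d| ^ 2)⁻¹ : ℝ) : ℂ) ≠ 0 := by
      exact_mod_cast (inv_pos.2 (pow_pos hda 2)).ne'
    rw [Complex.cpow_def_of_ne_zero hinv, Complex.cpow_def_of_ne_zero hdn,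
      ← Complex.ofReal_log (by positivity), ← Complex.ofReal_log hda.le, Real.log_inv,
      Real.log_pow]
    congr 1
    push_cast
    ring
  have hcay : (1 + (((x * Real.cos θ + Real.sin θ) / d : ℝ) : ℂ) * Complex.I) /
      (1 - (((x * Real.cos θ + Real.sin θ) / d : ℝ) : ℂ) * Complex.I) =
      Complex.exp (2 * θ * Complex.I) *
        ((1 + (x : ℂ) * Complex.I) / (1 - (x : ℂ) * Complex.I)) := by
    have h₁ : Complex.exp (2 * θ * Complex.I) =
        (Complex.cos θ + Complex.sin θ * Complex.I) ^ 2 := by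
      rw [← Complex.exp_mul_I, ← Complex.exp_nat_mul]
      congr 1
      push_cast; ring
    have hdv : (d : ℂ) = Complex.cos θ - x * Complex.sin θ := by rw [hd]; push_cast; rfl
    have hn := one_sub_mul_I_ne_zero x
    have hy := one_sub_mul_I_ne_zero ((x * Real.cos θ + Real.sin θ) / d)
    rw [div_eq_iff hy, h₁, mul_div_assoc', div_mul_eq_mul_div, eq_div_iff hn]
    push_cast
    field_simp
    rw [hdv]
    have hcs := Complex.sin_sq_add_cos_sq (θ : ℂ)
    generalize Complex.cos (θ : ℂ) = a at *
    generalize Complex.sin (θ : ℂ) = b at *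
    have hA : a - x * b + (x * a + b) * Complex.I =
        (a + b * Complex.I) * (1 + x * Complex.I) := by
      linear_combination -(b * x) * Complex.I_sq
    have hB : a - x * b - (x * a + b) * Complex.I =
        (a - b * Complex.I) * (1 - x * Complex.I) := by
      linear_combination -(b * x) * Complex.I_sq
    rw [hA, hB]
    linear_combination (a + b * Complex.I) * (1 + x * Complex.I) * (1 - x * Complex.I) *
      (b ^ 2 * Complex.I_sq - hcs)
  have hone : ((|d| : ℝ) : ℂ) ^ (-1 - s) * ((|d| : ℝ) : ℂ) ^ (1 + s) = 1 := by
    rw [← Complex.cpow_add _ _ (by exact_mod_cast hda.ne')]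
    simp
  have hexp : Complex.exp (2 * m * θ * Complex.I) = Complex.exp (2 * θ * Complex.I) ^ m := by
    rw [← Complex.exp_int_mul]
    congr 1
    ring
  rw [piPlus, vEven, vEven, ← hd, hpow, hcay, mul_zpow, hexp]
  linear_combination (((1 + x ^ 2 : ℝ) : ℂ) ^ (-(1 + s) / 2) *
    (Complex.exp (2 * θ * Complex.I) ^ m *
      ((1 + (x : ℂ) * Complex.I) / (1 - (x : ℂ) * Complex.I)) ^ m)) * hone

/-- Bound on the logarithmic derivative of `vEven (iλ) m`. -/
theorem norm_logDeriv_le (lam : ℝ) (m : ℤ) (x : ℝ) :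
    ‖(2 * m * Complex.I - (1 + Complex.I * lam) * x) / (1 + (x : ℂ) ^ 2)‖ ^ 2 ≤
      ((|lam| + 3) * (1 + |(m : ℝ)|)) ^ 2 * (1 + x ^ 2)⁻¹ := by
  have hp : 0 < 1 + x ^ 2 := by positivity
  have hden : ‖(1 + (x : ℂ) ^ 2)‖ = 1 + x ^ 2 := by
    rw [show (1 + (x : ℂ) ^ 2) = ((1 + x ^ 2 : ℝ) : ℂ) by push_cast; ring, Complex.norm_real,
      Real.norm_of_nonneg hp.le]
  set r := √(1 + x ^ 2) with hr
  have hr2 : r ^ 2 = 1 + x ^ 2 := Real.sq_sqrt hp.le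
  have hr1 : 1 ≤ r := Real.one_le_sqrt.2 (by nlinarith [sq_nonneg x])
  have hxr : |x| ≤ r := Real.abs_le_sqrt (by linarith)
  have hs : ‖1 + Complex.I * (lam : ℂ)‖ ≤ 1 + |lam| := (norm_add_le _ _).trans (by simp)
  have hnum : ‖2 * (m : ℂ) * Complex.I - (1 + Complex.I * lam) * x‖ ≤
      (|lam| + 3) * (1 + |(m : ℝ)|) * r := by
    refine (norm_sub_le _ _).trans ?_
    have h₁ : ‖2 * (m : ℂ) * Complex.I‖ = 2 * |(m : ℝ)| := by simp
    have h₂ : ‖(1 + Complex.I * (lam : ℂ)) * x‖ ≤ (1 + |lam|) * r := by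
      rw [norm_mul, Complex.norm_real, Real.norm_eq_abs]
      gcongr
    rw [h₁]
    have hm := abs_nonneg (m : ℝ)
    have hl := abs_nonneg lam
    nlinarith [mul_nonneg (mul_nonneg hl hm) (zero_le_one.trans hr1), mul_nonneg hm (sub_nonneg.2 hr1),
      mul_nonneg hm (zero_le_one.trans hr1)]
  rw [norm_div, hden, div_pow, ← div_eq_mul_inv, ← hr2, div_le_div_iff₀ (by positivity) (by positivity)]
  calc _ ≤ ((|lam| + 3) * (1 + |(m : ℝ)|) * r) ^ 2 * r ^ 2 := by gcongr
    _ = _ := by ring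

theorem lintegral_inv_one_add_sq :
    ∫⁻ x : ℝ, ENNReal.ofReal (1 + x ^ 2)⁻¹ = ENNReal.ofReal π := by
  rw [← ofReal_integral_eq_lintegral_ofReal integrable_inv_one_add_sq
    (ae_of_all _ fun x => by positivity), integral_univ_inv_one_add_sq]

theorem enorm_sq_eq_ofReal (z : ℂ) : ‖z‖ₑ ^ 2 = ENNReal.ofReal (‖z‖ ^ 2) := by
  rw [ENNReal.ofReal_pow (norm_nonneg _), ofReal_norm]

/-- Interpolation of the weight `|ξ|^s`, `s ∈ [0, 2]`, between `1` and `ξ²` at scale `M`. -/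
theorem abs_rpow_le_interpolation {s M : ℝ} (hs₀ : 0 ≤ s) (hs₂ : s ≤ 2) (hM : 0 < M) (ξ : ℝ) :
    |ξ| ^ s ≤ M ^ s * (1 + (M ^ 2)⁻¹ * ξ ^ 2) := by
  have ht : 0 ≤ |ξ| / M := by positivity
  have h : (|ξ| / M) ^ s ≤ 1 + (|ξ| / M) ^ 2 := by
    rcases le_total (|ξ| / M) 1 with h1 | h1
    · exact (Real.rpow_le_one ht h1 hs₀).trans (by nlinarith [sq_nonneg (|ξ| / M)])
    · have := Real.rpow_le_rpow_of_exponent_le h1 hs₂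
      rw [Real.rpow_two] at this
      linarith
  rw [Real.div_rpow (abs_nonneg _) hM.le, div_le_iff₀ (by positivity), div_pow, sq_abs] at h
  calc _ ≤ _ := h
    _ = _ := by ring

theorem IsImpFT.const_mul_of_ae {f g : ℝ → ℂ} {ξ : ℝ} {z : ℂ} (h : IsImpFT f ξ z) (a : ℂ)
    (hg : ∀ᵐ x, g x = a * f x) : IsImpFT g ξ (a * z) := by
  refine (Tendsto.const_mul a h).congr fun R => ?_
  rw [← integral_const_mul]
  refine integral_congr_ae (ae_restrict_of_ae ?_)
  filter_upwards [hg] with x hx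
  rw [hx]
  ring

theorem ae_cos_sub_mul_sin_ne_zero (θ : ℝ) :
    ∀ᵐ x : ℝ, Real.cos θ - x * Real.sin θ ≠ 0 := by
  refine measure_mono_null (t := {Real.cos θ / Real.sin θ}) (fun x hx => ?_) (by simp)
  have hx' : Real.cos θ - x * Real.sin θ = 0 := not_not.1 hx
  have hs : Real.sin θ ≠ 0 := fun h => by
    have := Real.sin_sq_add_cos_sq θ
    simp [h] at hx' this
    simp [hx'] at this
  rw [mem_singleton_iff, eq_div_iff hs]
  linarith

open FourierTransform in
/-- For `s ∈ [0, 2]`, the weighted energy of the improper Fourier transform of `vEven (iλ) m`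
is `O((1 + |m|)^s)`. -/
theorem exists_impFT_vEven (lam : ℝ) (m : ℤ) {s : ℝ} (hs₀ : 0 ≤ s) (hs₂ : s ≤ 2) :
    ∃ F : ℝ → ℂ, (∀ ξ ≠ 0, IsImpFT (vEven (Complex.I * lam) m) ξ (F ξ)) ∧
      ∫⁻ ξ, ENNReal.ofReal (|ξ| ^ s) * ‖F ξ‖ₑ ^ 2 ≤
        ENNReal.ofReal ((1 + |(m : ℝ)|) ^ s * (π + (|lam| + 3) ^ 2 * π)) := by
  set M := 1 + |(m : ℝ)| with hM
  have hM0 : 0 < M := by positivity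
  set K := |lam| + 3
  set f := vEven (Complex.I * lam) m with hf
  set q : ℝ → ℂ := fun x => (2 * m * Complex.I - (1 + Complex.I * lam) * x) / (1 + (x : ℂ) ^ 2)
    with hq
  set f' : ℝ → ℂ := fun x => f x * q x
  have hder : ∀ x, HasDerivAt f (f' x) x := hasDerivAt_vEven _ m
  have hfc : Continuous f := continuous_iff_continuousAt.2 fun x => (hder x).continuousAt
  have hqc : Continuous q := by
    refine Continuous.div (by fun_prop) (by fun_prop) fun x => ?_
    rw [show (1 + (x : ℂ) ^ 2) = ((1 + x ^ 2 : ℝ) : ℂ) by push_cast; ring]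
    exact_mod_cast (by positivity : (1 + x ^ 2) ≠ 0)
  have hf'c : Continuous f' := hfc.mul hqc
  have hnf : ∀ x, ‖f x‖ ^ 2 = (1 + x ^ 2)⁻¹ := norm_vEven_sq lam m
  have hnq : ∀ x, ‖q x‖ ^ 2 ≤ (K * M) ^ 2 * (1 + x ^ 2)⁻¹ := norm_logDeriv_le lam m
  have hnf' : ∀ x, ‖f' x‖ ≤ K * M * (1 + x ^ 2)⁻¹ := fun x => by
    refine abs_le_of_sq_le_sq' ?_ (by positivity) |>.2
    rw [norm_mul, mul_pow, hnf]
    calc _ ≤ (1 + x ^ 2)⁻¹ * ((K * M) ^ 2 * (1 + x ^ 2)⁻¹) := by gcongr; exact hnq x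
      _ = _ := by ring
  have hnf'2 : ∀ x, ‖f' x‖ ^ 2 ≤ (K * M) ^ 2 * (1 + x ^ 2)⁻¹ := fun x => by
    have h1 : (1 + x ^ 2)⁻¹ ≤ 1 := inv_le_one_of_one_le₀ (by nlinarith [sq_nonneg x])
    rw [norm_mul, mul_pow, hnf]
    calc _ ≤ 1 * ((K * M) ^ 2 * (1 + x ^ 2)⁻¹) := by gcongr; exact hnq x
      _ = _ := one_mul _
  have hint : Integrable f' :=
    (integrable_inv_one_add_sq.const_mul (K * M)).mono' hf'c.aestronglyMeasurable
      (ae_of_all _ hnf')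
  have hL2 : MemLp f' 2 := by
    rw [memLp_two_iff_integrable_sq_norm hf'c.aestronglyMeasurable]
    refine (integrable_inv_one_add_sq.const_mul ((K * M) ^ 2)).mono'
      (hf'c.norm.pow 2).aestronglyMeasurable (ae_of_all _ fun x => ?_)
    rw [Real.norm_of_nonneg (by positivity)]
    exact hnf'2 x
  have hlim : ∀ {l : Filter ℝ}, Tendsto (fun x : ℝ => x ^ 2) l atTop → Tendsto f l (nhds 0) := by
    intro l hl
    rw [tendsto_zero_iff_norm_tendsto_zero]
    have h2 : Tendsto (fun x => ‖f x‖ ^ 2) l (nhds 0) := by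
      simp only [hnf]
      exact (tendsto_atTop_add_const_left _ _ hl).inv_tendsto_atTop
    simpa using h2.sqrt
  have htop : Tendsto f atTop (nhds 0) := hlim (tendsto_pow_atTop two_ne_zero)
  have hbot : Tendsto f atBot (nhds 0) := hlim <| by
    simpa [Function.comp_def] using
      (tendsto_pow_atTop (α := ℝ) two_ne_zero).comp tendsto_neg_atBot_atTop
  set F : ℝ → ℂ := fun ξ => 𝓕 f' ξ / (2 * π * Complex.I * ξ) with hF
  have hFT : ∀ ξ ≠ 0, IsImpFT f ξ (F ξ) := fun ξ hξ =>
    isImpFT_of_hasDerivAt hder hf'c hint htop hbot hξ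
  refine ⟨F, hFT, ?_⟩
  have hFTc : Continuous (𝓕 f') :=
    VectorFourier.fourierIntegral_continuous (L := innerₗ ℝ) Real.continuous_fourierChar
      continuous_inner hint
  have hFm : Measurable F := hFTc.measurable.div (by fun_prop)
  have hE₀ : ∫⁻ ξ, ‖F ξ‖ₑ ^ 2 ≤ ENNReal.ofReal π := by
    refine (lintegral_enorm_sq_le_of_isImpFT hfc hFT).trans_eq ?_
    simp_rw [enorm_sq_eq_ofReal, hnf, lintegral_inv_one_add_sq]
  have hE₁ : ∫⁻ ξ : ℝ, ENNReal.ofReal (ξ ^ 2) * ‖F ξ‖ₑ ^ 2 ≤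
      ENNReal.ofReal ((K * M) ^ 2 * π) := by
    calc ∫⁻ ξ : ℝ, ENNReal.ofReal (ξ ^ 2) * ‖F ξ‖ₑ ^ 2 ≤ ∫⁻ ξ, ‖𝓕 f' ξ‖ₑ ^ 2 := by
          refine lintegral_mono fun ξ => ?_
          simp only [enorm_sq_eq_ofReal]
          rw [← ENNReal.ofReal_mul (sq_nonneg _)]
          refine ENNReal.ofReal_le_ofReal ?_
          rcases eq_or_ne ξ 0 with rfl | hξ
          · simp
          have hn : ‖(2 * π * Complex.I * ξ : ℂ)‖ ^ 2 = (2 * π) ^ 2 * ξ ^ 2 := by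
            simp [mul_pow]
          rw [hF, norm_div, div_pow, hn, mul_div_assoc', div_le_iff₀ (by positivity)]
          have hpi : 1 ≤ (2 * π) ^ 2 := one_le_pow₀ (by linarith [Real.pi_gt_three])
          nlinarith [mul_nonneg (sub_nonneg.2 hpi)
            (mul_nonneg (sq_nonneg ξ) (sq_nonneg ‖𝓕 f' ξ‖))]
      _ = ∫⁻ x, ‖f' x‖ₑ ^ 2 := lintegral_enorm_fourier_sq hint hL2
      _ ≤ ∫⁻ x : ℝ, ENNReal.ofReal ((K * M) ^ 2) * ENNReal.ofReal (1 + x ^ 2)⁻¹ := by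
          refine lintegral_mono fun x => ?_
          rw [enorm_sq_eq_ofReal, ← ENNReal.ofReal_mul (sq_nonneg _)]
          exact ENNReal.ofReal_le_ofReal (hnf'2 x)
      _ = ENNReal.ofReal ((K * M) ^ 2 * π) := by
          rw [lintegral_const_mul _ (by fun_prop), lintegral_inv_one_add_sq,
            ENNReal.ofReal_mul (sq_nonneg _)]
  calc ∫⁻ ξ, ENNReal.ofReal (|ξ| ^ s) * ‖F ξ‖ₑ ^ 2
      ≤ ∫⁻ ξ, ENNReal.ofReal (M ^ s) * (‖F ξ‖ₑ ^ 2 +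
          ENNReal.ofReal (M ^ 2)⁻¹ * (ENNReal.ofReal (ξ ^ 2) * ‖F ξ‖ₑ ^ 2)) := by
        refine lintegral_mono fun ξ => ?_
        calc _ ≤ ENNReal.ofReal (M ^ s * (1 + (M ^ 2)⁻¹ * ξ ^ 2)) * ‖F ξ‖ₑ ^ 2 := by
              gcongr
              exact abs_rpow_le_interpolation hs₀ hs₂ hM0 ξ
          _ = _ := by
              rw [ENNReal.ofReal_mul (by positivity), ENNReal.ofReal_add zero_le_one (by positivity),
                ENNReal.ofReal_mul (by positivity), ENNReal.ofReal_one]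
              ring
    _ = ENNReal.ofReal (M ^ s) * ((∫⁻ ξ, ‖F ξ‖ₑ ^ 2) +
          ENNReal.ofReal (M ^ 2)⁻¹ * ∫⁻ ξ : ℝ, ENNReal.ofReal (ξ ^ 2) * ‖F ξ‖ₑ ^ 2) := by
        rw [lintegral_const_mul _ (by fun_prop), lintegral_add_left (by fun_prop),
          lintegral_const_mul _ (by fun_prop)]
    _ ≤ ENNReal.ofReal (M ^ s) * (ENNReal.ofReal π +
          ENNReal.ofReal (M ^ 2)⁻¹ * ENNReal.ofReal ((K * M) ^ 2 * π)) := by gcongr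
    _ = ENNReal.ofReal (M ^ s * (π + K ^ 2 * π)) := by
        rw [← ENNReal.ofReal_mul (by positivity),
          ← ENNReal.ofReal_add Real.pi_pos.le (by positivity),
          ← ENNReal.ofReal_mul (by positivity)]
        congr 1
        field_simp

/-- for `u ∈ (−1,0)` the K-averaged complementary norm
`⫴v_{2m}^{(iλ)}⫴²_u = ∫₀^{2π} ∫ |ξ|^{−u} |𝓕(π_{iλ,+}(k_θ)v_{2m}^{(iλ)})(ξ)|² dξ dθ`
is bounded by `c_u (1+|m|)^{−u}`, the improper Fourier transforms existing for `ξ ≠ 0`. -/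
theorem stmt14 (u lam : ℝ) (hu : u ∈ Set.Ioo (-1 : ℝ) 0) :
    ∃ c : ℝ, 0 < c ∧
      ∀ m : ℤ, ∃ F : ℝ → ℝ → ℂ,
        (∀ θ : ℝ, ∀ ξ : ℝ, ξ ≠ 0 →
          IsImpFT (piPlus (Complex.I * lam) θ (vEven (Complex.I * lam) m)) ξ (F θ ξ)) ∧
        (∫⁻ θ in Ioc (0:ℝ) (2 * π),
            ∫⁻ ξ : ℝ, ENNReal.ofReal (|ξ| ^ (-u)) * (‖F θ ξ‖₊ : ℝ≥0∞) ^ 2)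
          ≤ ENNReal.ofReal (c * (1 + |(m : ℝ)|) ^ (-u)) := by
  obtain ⟨hu₁, hu₀⟩ := hu
  refine ⟨2 * π * (π + (|lam| + 3) ^ 2 * π), by positivity, fun m => ?_⟩
  obtain ⟨F, hF, hE⟩ := exists_impFT_vEven lam m (s := -u) (by linarith) (by linarith)
  refine ⟨fun θ ξ => Complex.exp (2 * m * θ * Complex.I) * F ξ, fun θ ξ hξ => ?_, ?_⟩
  · refine (hF ξ hξ).const_mul_of_ae _ ?_
    filter_upwards [ae_cos_sub_mul_sin_ne_zero θ] with x hx
    exact piPlus_vEven _ m θ x hx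
  · have hn : ∀ θ ξ : ℝ, (‖Complex.exp (2 * m * θ * Complex.I) * F ξ‖₊ : ℝ≥0∞) = ‖F ξ‖ₑ := by
      intro θ ξ
      have h : ‖Complex.exp (2 * m * θ * Complex.I)‖ₑ = 1 := by
        rw [show (2 * m * θ * Complex.I : ℂ) = ((2 * m * θ : ℝ) : ℂ) * Complex.I by push_cast; ring,
          ← ofReal_norm, Complex.norm_exp_ofReal_mul_I, ENNReal.ofReal_one]
      rw [← enorm_eq_nnnorm, enorm_mul, h, one_mul]
    simp only [hn, lintegral_const, Measure.restrict_apply_univ, Real.volume_Ioc, sub_zero]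
    calc _ ≤ ENNReal.ofReal ((1 + |(m : ℝ)|) ^ (-u) * (π + (|lam| + 3) ^ 2 * π)) *
          ENNReal.ofReal (2 * π) := by gcongr
      _ = _ := by
        rw [← ENNReal.ofReal_mul (by positivity)]
        congr 1
        ring
end
end
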